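/- Let F be a forest on a finite set I. Then the interval [0̂, F] is a lattice: any two forests F₁ ⊆ F and F₂ ⊆ F have a least upper bound and a greatest lower bound in the poset ({F' : F' ⊆ F}, ⊆). (In particular, for every forest F on I there exists a tree T on I with F ⊆ T.) -/

import Mathlib

/-- A forest on `I`: a partial order on `I` such that the set of elements below any
element is totally ordered (a chain). -/
structure Forest (I : Type*) where
  le : I → I → Prop
  le_refl : ∀ i, le i i
  le_trans : ∀ ⦃i j k⦄, le i j → le j k → le i k
  le_antisymm : ∀ ⦃i j⦄, le i j → le j i → i = j
  downset_chain : ∀ ⦃i j k⦄, le j i → le k i → le j k ∨ le k j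

namespace Forest

variable {I : Type*}

/-- Strict order associated to a forest. -/
def lt (F : Forest I) (i j : I) : Prop := F.le i j ∧ i ≠ j

/-- A root of a forest: a minimal element. -/
def IsRoot (F : Forest I) (r : I) : Prop := ∀ j, F.le j r → j = r

/-- A node of a forest: a vertex which is not a root, i.e. has some vertex
strictly below it. -/
def IsNode (F : Forest I) (i : I) : Prop := ∃ j, F.lt j i

/-- The set `N(F)` of nodes of a forest. -/
def nodes (F : Forest I) : Set I := {i | F.IsNode i}

/-- `i` and `j` lie in the same block of the partition `π(F)` of `I` associated
to `F`, i.e. they lie above a common root. -/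
def sameBlock (F : Forest I) (i j : I) : Prop :=
  ∃ r, F.IsRoot r ∧ F.le r i ∧ F.le r j

/-- The partial order `⊆` on forests: `F' ⊆ F` iff `≤_{F'}` implies `≤_F` and
each tree of `F'` is induced by `F` as a poset (elements of a common block of
`π(F')` that are comparable in `F` are comparable in `F'`). -/
def Sub (F' F : Forest I) : Prop :=
  (∀ i j, F'.le i j → F.le i j) ∧
  (∀ i j, F'.sameBlock i j → F.le i j → F'.le i j)

/-- A tree is a forest with a (necessarily unique) minimal element lying below
every vertex. -/
def IsTree (T : Forest I) : Prop := ∃ r : I, ∀ i, T.le r i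

end Forest

namespace Forest

variable {I : Type*}

theorem exists_isRoot_le [Finite I] (F : Forest I) (i : I) : ∃ r, F.IsRoot r ∧ F.le r i := by
  let P : PartialOrder I :=
    { le := F.le, le_refl := F.le_refl, le_trans := F.le_trans, le_antisymm := F.le_antisymm }
  obtain ⟨r, hri, hr⟩ := exists_minimal_le_of_wellFoundedLT (fun _ : I => True) i trivial
  exact ⟨r, fun j hj => F.le_antisymm hj (hr.2 trivial hj), hri⟩

theorem sameBlock_refl [Finite I] (F : Forest I) (i : I) : F.sameBlock i i :=
  let ⟨r, hr, hri⟩ := F.exists_isRoot_le i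
  ⟨r, hr, hri, hri⟩

theorem sameBlock_of_le_of_le [Finite I] (F : Forest I) {r i j : I} (hi : F.le r i)
    (hj : F.le r j) : F.sameBlock i j :=
  let ⟨s, hs, hsr⟩ := F.exists_isRoot_le r
  ⟨s, hs, F.le_trans hsr hi, F.le_trans hsr hj⟩

theorem sameBlock_of_le [Finite I] (F : Forest I) {i j : I} (h : F.le i j) : F.sameBlock i j :=
  F.sameBlock_of_le_of_le (F.le_refl i) h

theorem sameBlock_symm (F : Forest I) {i j : I} : F.sameBlock i j → F.sameBlock j i :=
  fun ⟨r, hr, hi, hj⟩ => ⟨r, hr, hj, hi⟩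

theorem sameBlock_trans (F : Forest I) {i j k : I} :
    F.sameBlock i j → F.sameBlock j k → F.sameBlock i k := by
  rintro ⟨r, hr, hri, hrj⟩ ⟨s, hs, hsj, hsk⟩
  have hrs : r = s := (F.downset_chain hrj hsj).elim (hs r) fun h => (hr s h).symm
  exact ⟨r, hr, hri, hrs ▸ hsk⟩

/-- Among forests contained in `F`, containment amounts to inclusion of the order relations. -/
theorem Sub.of_le {F G H : Forest I} (hG : G.Sub F) (hH : H.Sub F)
    (h : ∀ i j, G.le i j → H.le i j) : G.Sub H :=
  ⟨h, fun i j hij hle => hG.2 i j hij (hH.1 i j hle)⟩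

/-- The restriction of the order of `F` to the classes of a setoid. -/
def restrict (F : Forest I) (s : Setoid I) : Forest I where
  le i j := F.le i j ∧ s i j
  le_refl i := ⟨F.le_refl i, s.refl i⟩
  le_trans _ _ _ h h' := ⟨F.le_trans h.1 h'.1, s.trans h.2 h'.2⟩
  le_antisymm _ _ h h' := F.le_antisymm h.1 h'.1
  downset_chain _ _ _ h h' := (F.downset_chain h.1 h'.1).imp
    (fun hjk => ⟨hjk, s.trans h.2 (s.symm h'.2)⟩) (fun hkj => ⟨hkj, s.trans h'.2 (s.symm h.2)⟩)

theorem restrict_sub (F : Forest I) (s : Setoid I) : (F.restrict s).Sub F :=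
  ⟨fun _ _ h => h.1, fun _ _ ⟨_, _, hi, hj⟩ h => ⟨h, s.trans (s.symm hi.2) hj.2⟩⟩

/-- The partition of `I` into the blocks of `F`, as a setoid. -/
def blockSetoid [Finite I] (F : Forest I) : Setoid I where
  r := F.sameBlock
  iseqv := ⟨F.sameBlock_refl, F.sameBlock_symm, F.sameBlock_trans⟩

theorem exists_join [Finite I] {F F₁ F₂ : Forest I} (h₁ : F₁.Sub F) (h₂ : F₂.Sub F) :
    ∃ S : Forest I, S.Sub F ∧ F₁.Sub S ∧ F₂.Sub S ∧
      ∀ G : Forest I, G.Sub F → F₁.Sub G → F₂.Sub G → S.Sub G := by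
  let s : Setoid I := Relation.EqvGen.setoid fun i j => F₁.le i j ∨ F₂.le i j
  have hS := F.restrict_sub s
  refine ⟨F.restrict s, hS,
    h₁.of_le hS fun i j h => ⟨h₁.1 i j h, .rel _ _ (.inl h)⟩,
    h₂.of_le hS fun i j h => ⟨h₂.1 i j h, .rel _ _ (.inr h)⟩, fun G hG hG₁ hG₂ => ?_⟩
  have hs : s ≤ G.blockSetoid := Setoid.eqvGen_le fun i j h =>
    G.sameBlock_of_le (h.elim (hG₁.1 i j) (hG₂.1 i j))
  exact hS.of_le hG fun i j h => hG.2 i j (hs h.2) h.1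

theorem exists_meet [Finite I] {F F₁ F₂ : Forest I} (h₁ : F₁.Sub F) (h₂ : F₂.Sub F) :
    ∃ M : Forest I, M.Sub F ∧ M.Sub F₁ ∧ M.Sub F₂ ∧
      ∀ G : Forest I, G.Sub F → G.Sub F₁ → G.Sub F₂ → G.Sub M := by
  let M : Forest I :=
    { le i j := F₁.le i j ∧ F₂.le i j
      le_refl i := ⟨F₁.le_refl i, F₂.le_refl i⟩
      le_trans _ _ _ h h' := ⟨F₁.le_trans h.1 h'.1, F₂.le_trans h.2 h'.2⟩
      le_antisymm _ _ h h' := F₁.le_antisymm h.1 h'.1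
      downset_chain i j k h h' := (F.downset_chain (h₁.1 j i h.1) (h₁.1 k i h'.1)).imp
        (fun hjk => ⟨h₁.2 j k (F₁.sameBlock_trans (F₁.sameBlock_of_le h.1)
            (F₁.sameBlock_symm (F₁.sameBlock_of_le h'.1))) hjk,
          h₂.2 j k (F₂.sameBlock_trans (F₂.sameBlock_of_le h.2)
            (F₂.sameBlock_symm (F₂.sameBlock_of_le h'.2))) hjk⟩)
        (fun hkj => ⟨h₁.2 k j (F₁.sameBlock_trans (F₁.sameBlock_of_le h'.1)
            (F₁.sameBlock_symm (F₁.sameBlock_of_le h.1))) hkj,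
          h₂.2 k j (F₂.sameBlock_trans (F₂.sameBlock_of_le h'.2)
            (F₂.sameBlock_symm (F₂.sameBlock_of_le h.2))) hkj⟩) }
  have hM : M.Sub F := ⟨fun i j h => h₁.1 i j h.1, fun i j ⟨_, _, hi, hj⟩ h =>
    ⟨h₁.2 i j (F₁.sameBlock_of_le_of_le hi.1 hj.1) h,
      h₂.2 i j (F₂.sameBlock_of_le_of_le hi.2 hj.2) h⟩⟩
  exact ⟨M, hM, hM.of_le h₁ fun _ _ h => h.1, hM.of_le h₂ fun _ _ h => h.2,
    fun G hG hG₁ hG₂ => hG.of_le hM fun i j h => ⟨hG₁.1 i j h, hG₂.1 i j h⟩⟩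

/-- The tree obtained from a forest by placing one of its roots below all vertices. -/
def treeOfRoot (F : Forest I) (r : I) (hr : F.IsRoot r) : Forest I where
  le i j := F.le i j ∨ i = r
  le_refl i := .inl (F.le_refl i)
  le_trans := by
    rintro i j k (h | rfl) (h' | rfl)
    · exact .inl (F.le_trans h h')
    · exact .inr (hr i h)
    · exact .inr rfl
    · exact .inr rfl
  le_antisymm := by
    rintro i j (h | rfl) (h' | h')
    · exact F.le_antisymm h h'
    · subst h'
      exact hr i h
    · exact (hr j h').symm
    · exact h'.symm
  downset_chain := by
    rintro i j k (h | rfl) (h' | rfl)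
    · exact (F.downset_chain h h').imp .inl .inl
    · exact .inr (.inr rfl)
    · exact .inl (.inr rfl)
    · exact .inl (.inr rfl)

theorem exists_isTree_sub [Finite I] [Nonempty I] (F : Forest I) :
    ∃ T : Forest I, T.IsTree ∧ F.Sub T := by
  obtain ⟨r, hr, -⟩ := F.exists_isRoot_le (Classical.arbitrary I)
  refine ⟨F.treeOfRoot r hr, ⟨r, fun _ => .inr rfl⟩, fun _ _ => .inl, ?_⟩
  rintro i j ⟨s, -, hsi, hsj⟩ (h | rfl)
  · exact h
  · exact hr s hsi ▸ hsj

end Forest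

/-- the interval `[0̂, F]` in the poset of forests on `I` is a
lattice: any two forests `F₁ ⊆ F` and `F₂ ⊆ F` have a least upper bound and a
greatest lower bound among the forests `⊆ F`. In particular every forest is
contained in some tree. -/
theorem interval_is_lattice {I : Type*} [Finite I] [Nonempty I] (F : Forest I) :
    (∀ F₁ F₂ : Forest I, F₁.Sub F → F₂.Sub F →
      (∃ S : Forest I, S.Sub F ∧ F₁.Sub S ∧ F₂.Sub S ∧
        ∀ G : Forest I, G.Sub F → F₁.Sub G → F₂.Sub G → S.Sub G) ∧
      (∃ M : Forest I, M.Sub F ∧ M.Sub F₁ ∧ M.Sub F₂ ∧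
        ∀ G : Forest I, G.Sub F → G.Sub F₁ → G.Sub F₂ → G.Sub M)) ∧
    (∃ T : Forest I, T.IsTree ∧ F.Sub T) := by
  exact ⟨fun _ _ h₁ h₂ => ⟨Forest.exists_join h₁ h₂, Forest.exists_meet h₁ h₂⟩,
    F.exists_isTree_sub⟩
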